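/- arXiv:2101.08761 — 4 statements merged into one kernel-verified Lean document; each statement's English description precedes it below -/
import Mathlib

section
/- Let p be a prime that does not divide 840. Then p ≡ 1 (mod 12) and (−8/p) = (−7/p) = (−4/p) = (−15/p) = (−12/p) = 1 hold simultaneously if and only if p mod 840 ∈ {1, 121, 169, 289, 361, 529}. -/
open scoped NumberTheorySymbols

/-- For a prime `p ≡ 1 (mod 4)` and odd `n`, the symbol `(-n/p)` equals `(p mod n / n)`. -/
theorem legendreSym_neg_natCast_eq_jacobiSym_mod {p : ℕ} [Fact p.Prime] (h4 : p % 4 = 1)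
    {n : ℕ} (hn : Odd n) : legendreSym p (-(n : ℤ)) = J(((p % n : ℕ) : ℤ) | n) := by
  have hodd : Odd p := Nat.odd_iff.mpr (by omega)
  rw [jacobiSym.legendreSym.to_jacobiSym, jacobiSym.neg _ hodd, ZMod.χ₄_nat_one_mod_four h4,
    one_mul, jacobiSym.quadratic_reciprocity_one_mod_four' hn h4, jacobiSym.mod_left]
  norm_cast

/-- Multiplying the argument by `4` does not change the Legendre symbol at an odd prime. -/
theorem legendreSym_mul_four {p : ℕ} [Fact p.Prime] (hodd : Odd p) (a : ℤ) :
    legendreSym p (a * 4) = legendreSym p a := by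
  simp only [jacobiSym.legendreSym.to_jacobiSym]
  rw [jacobiSym.mul_left, jacobiSym.at_four hodd, mul_one]

/-- For an odd prime `p`, `(-8/p) = 1` iff `p ≡ 1` or `3 (mod 8)`. -/
theorem legendreSym_neg_eight_eq_one_iff {p : ℕ} [Fact p.Prime] (hodd : Odd p) :
    legendreSym p (-8) = 1 ↔ p % 8 = 1 ∨ p % 8 = 3 := by
  have h2 : p % 2 = 1 := Nat.odd_iff.mp hodd
  rw [show (-8 : ℤ) = -2 * 4 by norm_num, legendreSym_mul_four hodd,
    jacobiSym.legendreSym.to_jacobiSym, jacobiSym.at_neg_two hodd, ZMod.χ₈'_nat_eq_if_mod_eight]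
  split_ifs <;> first | omega | simp_all

/-- The values at which the Jacobi symbol modulo `7` is `1`. -/
theorem jacobiSym_seven_eq_one_iff {r : ℕ} (hr : r < 7) :
    J((r : ℤ) | 7) = 1 ↔ r = 1 ∨ r = 2 ∨ r = 4 := by
  interval_cases r <;> norm_num

/-- The values at which the Jacobi symbol modulo `15` is `1`. -/
theorem jacobiSym_fifteen_eq_one_iff {r : ℕ} (hr : r < 15) :
    J((r : ℤ) | 15) = 1 ↔ r = 1 ∨ r = 2 ∨ r = 4 ∨ r = 8 := by
  interval_cases r <;> norm_num

theorem stmt_2 (p : ℕ) [Fact p.Prime] (hp : ¬ p ∣ 840) :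
    (p % 12 = 1 ∧ legendreSym p (-8) = 1 ∧ legendreSym p (-7) = 1 ∧
      legendreSym p (-4) = 1 ∧ legendreSym p (-15) = 1 ∧ legendreSym p (-12) = 1) ↔
    p % 840 ∈ ({1, 121, 169, 289, 361, 529} : Finset ℕ) := by
  simp only [Finset.mem_insert, Finset.mem_singleton]
  by_cases h12 : p % 12 = 1
  swap
  · exact ⟨fun h => absurd h.1 h12, fun h => by omega⟩
  have h4 : p % 4 = 1 := by omega
  have hodd : Odd p := Nat.odd_iff.mpr (by omega)
  have e4 : legendreSym p (-4) = 1 := by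
    rw [show (-4 : ℤ) = -1 * 4 by norm_num, legendreSym_mul_four hodd,
      jacobiSym.legendreSym.to_jacobiSym, jacobiSym.at_neg_one hodd,
      ZMod.χ₄_nat_one_mod_four h4]
  have e12 : legendreSym p (-12) = 1 := by
    have h := legendreSym_neg_natCast_eq_jacobiSym_mod h4 (n := 3) (by decide)
    rw [show p % 3 = 1 by omega, Nat.cast_one, jacobiSym.one_left] at h
    rw [show (-12 : ℤ) = -(3 : ℕ) * 4 by norm_num, legendreSym_mul_four hodd, h]
  have e7 : legendreSym p (-7) = 1 ↔ p % 7 = 1 ∨ p % 7 = 2 ∨ p % 7 = 4 := by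
    rw [← jacobiSym_seven_eq_one_iff (Nat.mod_lt p (by norm_num)),
      ← legendreSym_neg_natCast_eq_jacobiSym_mod h4 (n := 7) (by decide), Nat.cast_ofNat]
  have e15 : legendreSym p (-15) = 1 ↔
      p % 15 = 1 ∨ p % 15 = 2 ∨ p % 15 = 4 ∨ p % 15 = 8 := by
    rw [← jacobiSym_fifteen_eq_one_iff (Nat.mod_lt p (by norm_num)),
      ← legendreSym_neg_natCast_eq_jacobiSym_mod h4 (n := 15) (by decide), Nat.cast_ofNat]
  simp only [e4, e12, e7, e15, legendreSym_neg_eight_eq_one_iff hodd, h12, true_and, and_true]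
  omega
end

section
/- Let p be a prime that does not divide 9240. Then p ≡ 1 (mod 12) together with (−12/p) = (−11/p) = (−8/p) = (−3/p) = 1 and (−35/p) = (−32/p) = (−27/p) = (−20/p) = 1 hold simultaneously if and only if p mod 9240 ∈ {1, 169, 289, 361, 529, 841, 961, 1369, 1681, 1849, 2209, 2641, 2689, 2809, 3481, 3529, 3721, 4321, 4489, 5041, 5329, 5569, 6169, 6241, 6889, 7561, 7681, 7921, 8089, 8761}. -/
theorem legendreSym_neg_of_one_mod_four {p : ℕ} [Fact p.Prime] (h : p % 4 = 1) (a : ℤ) :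
    legendreSym p (-a) = legendreSym p a := by
  have h1 : legendreSym p (-1) = 1 := by
    rw [legendreSym.at_neg_one (by omega), ZMod.χ₄_nat_one_mod_four h]
  rw [neg_eq_neg_one_mul, legendreSym.mul, h1, one_mul]

theorem legendreSym_mul_sq_of_not_dvd {p : ℕ} [Fact p.Prime] {b : ℕ} (h : ¬ p ∣ b) (a : ℤ) :
    legendreSym p (a * (b : ℤ) ^ 2) = legendreSym p a := by
  rw [legendreSym.mul, legendreSym.sq_one' p (by simpa [ZMod.natCast_eq_zero_iff] using h),
    mul_one]

theorem legendreSym_eq_mod_of_one_mod_four {p q : ℕ} [Fact p.Prime] [Fact q.Prime]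
    (h : p % 4 = 1) (hq : q ≠ 2) : legendreSym p q = legendreSym q ((p % q : ℕ) : ℤ) := by
  rw [← legendreSym.quadratic_reciprocity_one_mod_four h hq, legendreSym.mod, Int.natCast_mod]

theorem legendreSym_two_eq_one_iff {p : ℕ} [Fact p.Prime] (h : p % 4 = 1) :
    legendreSym p 2 = 1 ↔ p % 8 = 1 := by
  rw [legendreSym.at_two (by omega), ZMod.χ₈_nat_eq_if_mod_eight]
  have hodd : p % 2 ≠ 0 := by omega
  have hr : p % 8 ≠ 7 := by omega
  simp [hodd, hr]

theorem legendreSym_three_eq_one_iff {p : ℕ} [Fact p.Prime] (h : p % 4 = 1) (hp : ¬ 3 ∣ p) :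
    legendreSym p 3 = 1 ↔ p % 3 = 1 := by
  have key := legendreSym_eq_mod_of_one_mod_four (q := 3) h (by norm_num)
  have hr : p % 3 = 1 ∨ p % 3 = 2 := by omega
  rw [Nat.cast_ofNat] at key
  rw [key]
  rcases hr with hr | hr <;> rw [hr] <;> norm_num

theorem legendreSym_five_eq_one_iff {p : ℕ} [Fact p.Prime] (h : p % 4 = 1) :
    legendreSym p 5 = 1 ↔ p % 5 = 1 ∨ p % 5 = 4 := by
  have : Fact (Nat.Prime 5) := ⟨by norm_num⟩
  have key := legendreSym_eq_mod_of_one_mod_four (q := 5) h (by norm_num)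
  have hr : p % 5 < 5 := Nat.mod_lt _ (by norm_num)
  rw [Nat.cast_ofNat] at key
  rw [key]
  interval_cases p % 5 <;> norm_num

theorem legendreSym_seven_eq_one_iff {p : ℕ} [Fact p.Prime] (h : p % 4 = 1) :
    legendreSym p 7 = 1 ↔ p % 7 = 1 ∨ p % 7 = 2 ∨ p % 7 = 4 := by
  have : Fact (Nat.Prime 7) := ⟨by norm_num⟩
  have key := legendreSym_eq_mod_of_one_mod_four (q := 7) h (by norm_num)
  have hr : p % 7 < 7 := Nat.mod_lt _ (by norm_num)
  rw [Nat.cast_ofNat] at key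
  rw [key]
  interval_cases p % 7 <;> norm_num

theorem legendreSym_eleven_eq_one_iff {p : ℕ} [Fact p.Prime] (h : p % 4 = 1) :
    legendreSym p 11 = 1 ↔
      p % 11 = 1 ∨ p % 11 = 3 ∨ p % 11 = 4 ∨ p % 11 = 5 ∨ p % 11 = 9 := by
  have : Fact (Nat.Prime 11) := ⟨by norm_num⟩
  have key := legendreSym_eq_mod_of_one_mod_four (q := 11) h (by norm_num)
  have hr : p % 11 < 11 := Nat.mod_lt _ (by norm_num)
  rw [Nat.cast_ofNat] at key
  rw [key]
  interval_cases p % 11 <;> norm_num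

theorem legendreSym_conditions_iff {p : ℕ} [Fact p.Prime] (hp : ¬ p ∣ 9240)
    (h12 : p % 12 = 1) :
    (legendreSym p (-12) = 1 ∧ legendreSym p (-11) = 1 ∧
      legendreSym p (-8) = 1 ∧ legendreSym p (-3) = 1 ∧
      legendreSym p (-35) = 1 ∧ legendreSym p (-32) = 1 ∧
      legendreSym p (-27) = 1 ∧ legendreSym p (-20) = 1) ↔
    p % 8 = 1 ∧ (p % 5 = 1 ∨ p % 5 = 4) ∧ (p % 7 = 1 ∨ p % 7 = 2 ∨ p % 7 = 4) ∧
      (p % 11 = 1 ∨ p % 11 = 3 ∨ p % 11 = 4 ∨ p % 11 = 5 ∨ p % 11 = 9) := by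
  have h4 : p % 4 = 1 := by omega
  have hdvd {a : ℕ} (ha : a ∣ 9240) : ¬ p ∣ a := fun h => hp (h.trans ha)
  have h2 := hdvd (a := 2) (by norm_num)
  have h3 := hdvd (a := 3) (by norm_num)
  have h4' := hdvd (a := 4) (by norm_num)
  have e12 : legendreSym p 12 = legendreSym p 3 := legendreSym_mul_sq_of_not_dvd h2 3
  have e8 : legendreSym p 8 = legendreSym p 2 := legendreSym_mul_sq_of_not_dvd h2 2
  have e32 : legendreSym p 32 = legendreSym p 2 := legendreSym_mul_sq_of_not_dvd h4' 2
  have e27 : legendreSym p 27 = legendreSym p 3 := legendreSym_mul_sq_of_not_dvd h3 3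
  have e20 : legendreSym p 20 = legendreSym p 5 := legendreSym_mul_sq_of_not_dvd h2 5
  have e35 : legendreSym p 35 = legendreSym p 5 * legendreSym p 7 := legendreSym.mul p 5 7
  have l3 : legendreSym p 3 = 1 :=
    (legendreSym_three_eq_one_iff h4 (by omega)).2 (by omega)
  simp only [legendreSym_neg_of_one_mod_four h4, e12, e8, e32, e27, e20, e35, l3,
    ← legendreSym_two_eq_one_iff h4, ← legendreSym_five_eq_one_iff h4,
    ← legendreSym_seven_eq_one_iff h4, ← legendreSym_eleven_eq_one_iff h4]
  constructor
  · rintro ⟨-, h11, h2, -, h35, -, -, h5⟩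
    exact ⟨h2, h5, by simpa [h5] using h35, h11⟩
  · rintro ⟨h2, h5, h7, h11⟩
    simp [h2, h5, h7, h11]

theorem stmt_3 (p : ℕ) [Fact p.Prime] (hp : ¬ p ∣ 9240) :
    (p % 12 = 1 ∧ legendreSym p (-12) = 1 ∧ legendreSym p (-11) = 1 ∧
      legendreSym p (-8) = 1 ∧ legendreSym p (-3) = 1 ∧
      legendreSym p (-35) = 1 ∧ legendreSym p (-32) = 1 ∧
      legendreSym p (-27) = 1 ∧ legendreSym p (-20) = 1) ↔
    p % 9240 ∈ ({1, 169, 289, 361, 529, 841, 961, 1369, 1681, 1849, 2209, 2641,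
      2689, 2809, 3481, 3529, 3721, 4321, 4489, 5041, 5329, 5569, 6169, 6241,
      6889, 7561, 7681, 7921, 8089, 8761} : Finset ℕ) := by
  rw [and_congr_right fun h => legendreSym_conditions_iff hp h]
  have h12 : p % 9240 % 12 = p % 12 := Nat.mod_mod_of_dvd _ (by norm_num)
  have h8 : p % 9240 % 8 = p % 8 := Nat.mod_mod_of_dvd _ (by norm_num)
  have h5 : p % 9240 % 5 = p % 5 := Nat.mod_mod_of_dvd _ (by norm_num)
  have h7 : p % 9240 % 7 = p % 7 := Nat.mod_mod_of_dvd _ (by norm_num)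
  have h11 : p % 9240 % 11 = p % 11 := Nat.mod_mod_of_dvd _ (by norm_num)
  rw [← h12, ← h8, ← h5, ← h7, ← h11]
  have hr : p % 9240 < 9240 := Nat.mod_lt _ (by norm_num)
  generalize p % 9240 = r at hr
  clear h12 h8 h5 h7 h11
  constructor
  · rintro ⟨h12, h8, h⟩
    obtain ⟨k, rfl⟩ : ∃ k, r = 24 * k + 1 := ⟨r / 24, by omega⟩
    have hk : k < 385 := by omega
    clear hr h12 h8
    revert h
    revert k
    decide +kernel
  · intro h
    clear hr
    revert r
    decide +kernel
end

section
/- Let n and ℓ be positive integers and let B be a symmetric n×n matrix with nonnegative integer entries such that every row of B sums to ℓ + 1 and every entry of B is at most ℓ. Let r = Σ_{i<j} max(B_ij − 1, 0) + Σ_i max(B_ii − 1, 0) be the number of redundant edges, and let T = Tr(B·B) − ℓ·n. Then 2·r ≤ T − n ≤ 2·ℓ·r; equivalently, (T − n)/(2ℓ) ≤ r ≤ (T − n)/2. -/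
/-- The sum of all entries of a symmetric array is twice the sum above the diagonal plus the sum
on the diagonal. -/
theorem sum_sum_eq_two_mul_sum_lt_add_sum_diag {ι R : Type*} [Fintype ι] [LinearOrder ι]
    [CommSemiring R] (f : ι → ι → R) (hf : ∀ i j, f i j = f j i) :
    ∑ i, ∑ j, f i j = 2 * (∑ i, ∑ j, if i < j then f i j else 0) + ∑ i, f i i := by
  have hsplit : ∀ i j, f i j =
      (if i < j then f i j else 0) + (if j < i then f j i else 0) + (if i = j then f i j else 0) := by
    intro i j
    rcases lt_trichotomy i j with h | rfl | h
    · simp [h, h.not_gt, h.ne]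
    · simp
    · simp [h, h.not_gt, h.ne', hf i j]
  have hcomm : ∑ i, ∑ j, (if j < i then f j i else 0) = ∑ i, ∑ j, if i < j then f i j else 0 :=
    Finset.sum_comm
  calc ∑ i, ∑ j, f i j
      = ∑ i, ∑ j, ((if i < j then f i j else 0) + (if j < i then f j i else 0)
          + (if i = j then f i j else 0)) :=
        Finset.sum_congr rfl fun i _ => Finset.sum_congr rfl fun j _ => hsplit i j
    _ = 2 * (∑ i, ∑ j, if i < j then f i j else 0) + ∑ i, f i i := by
        simp only [Finset.sum_add_distrib, hcomm, Finset.sum_ite_eq, Finset.mem_univ, if_true]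
        ring

theorem two_mul_max_sub_one_le_mul_sub_one {x : ℤ} (hx : 0 ≤ x) :
    2 * max (x - 1) 0 ≤ x * (x - 1) := by
  rcases le_or_gt x 1 with h | h
  · rw [max_eq_right (by linarith)]
    obtain rfl | rfl : x = 0 ∨ x = 1 := by omega
    all_goals norm_num
  · rw [max_eq_left (by linarith)]
    exact mul_le_mul_of_nonneg_right h (by linarith)

theorem mul_sub_one_le_mul_max_sub_one {x b : ℤ} (hx : 0 ≤ x) (hxb : x ≤ b) :
    x * (x - 1) ≤ b * max (x - 1) 0 :=
  calc x * (x - 1) ≤ x * max (x - 1) 0 := mul_le_mul_of_nonneg_left (le_max_left _ _) hx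
    _ ≤ b * max (x - 1) 0 := mul_le_mul_of_nonneg_right hxb (le_max_right _ _)

theorem stmt_6 (n ℓ : ℕ) (hn : 0 < n) (hℓ : 0 < ℓ)
    (B : Matrix (Fin n) (Fin n) ℤ)
    (hsymm : B.IsSymm) (hnonneg : ∀ i j, 0 ≤ B i j)
    (hrow : ∀ i, ∑ j, B i j = ℓ + 1)
    (hent : ∀ i j, B i j ≤ ℓ)
    (r : ℤ) (hr : r = (∑ i, ∑ j, if i < j then max (B i j - 1) 0 else 0)
      + ∑ i, max (B i i - 1) 0)
    (T : ℤ) (hT : T = Matrix.trace (B * B) - (ℓ : ℤ) * (n : ℤ)) :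
    2 * r ≤ T - (n : ℤ) ∧ T - (n : ℤ) ≤ 2 * (ℓ : ℤ) * r := by
  have htrace : T - n = ∑ i, ∑ j, B i j * (B i j - 1) := by
    have hsq : Matrix.trace (B * B) = ∑ i, ∑ j, B i j * B i j := by
      simp only [Matrix.trace, Matrix.diag, Matrix.mul_apply]
      exact Finset.sum_congr rfl fun i _ => Finset.sum_congr rfl fun j _ => by
        rw [hsymm.apply i j]
    simp only [mul_sub, mul_one, Finset.sum_sub_distrib, hrow, Finset.sum_const,
      Finset.card_univ, Fintype.card_fin, nsmul_eq_mul]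
    rw [hT, hsq]
    ring
  have hsum := sum_sum_eq_two_mul_sum_lt_add_sum_diag (fun i j => max (B i j - 1) 0)
    fun i j => by rw [hsymm.apply i j]
  have hlower : 2 * ∑ i, ∑ j, max (B i j - 1) 0 ≤ T - n := by
    rw [htrace]
    simp only [Finset.mul_sum]
    exact Finset.sum_le_sum fun i _ => Finset.sum_le_sum fun j _ =>
      two_mul_max_sub_one_le_mul_sub_one (hnonneg i j)
  have hupper : T - n ≤ ℓ * ∑ i, ∑ j, max (B i j - 1) 0 := by
    rw [htrace]
    simp only [Finset.mul_sum]
    exact Finset.sum_le_sum fun i _ => Finset.sum_le_sum fun j _ =>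
      mul_sub_one_le_mul_max_sub_one (hnonneg i j) (hent i j)
  have hdiag : 0 ≤ ∑ i, max (B i i - 1) 0 := Finset.sum_nonneg fun i _ => le_max_right _ _
  have hoff : 0 ≤ ∑ i, ∑ j, if i < j then max (B i j - 1) 0 else 0 :=
    Finset.sum_nonneg fun i _ => Finset.sum_nonneg fun j _ => by
      split_ifs
      exacts [le_max_right _ _, le_rfl]
  have hscaled := mul_nonneg (Int.natCast_nonneg ℓ) hdiag
  rw [hsum] at hlower hupper
  rw [hr]
  constructor <;> linarith
end

section
/- Let ℓ₁ < ℓ₂ be prime numbers and let r, s ≥ 1 be integers. Then, as real numbers, Σ_{d | ℓ₁^r ℓ₂^s, d² > ℓ₁^r ℓ₂^s} d ≤ ( ℓ₁^{r+1} ℓ₂^{s+1} − ℓ₂^{s+1} − (ℓ₁ − 1)(r + 1)·√(ℓ₁^r ℓ₂^s) ) / ( (ℓ₁ − 1)(ℓ₂ − 1) ), where the sum runs over the positive divisors d of ℓ₁^r ℓ₂^s exceeding √(ℓ₁^r ℓ₂^s). -/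
open Finset in
theorem sum_divisors_mul_prime_pow {M : Type*} [AddCommMonoid M] {p q : ℕ} (hp : p.Prime)
    (hq : q.Prime) (hpq : p ≠ q) (r s : ℕ) (f : ℕ → M) :
    ∑ d ∈ (p ^ r * q ^ s).divisors, f d =
      ∑ i ∈ range (r + 1), ∑ j ∈ range (s + 1), f (p ^ i * q ^ j) := by
  have hcop : (p ^ r).Coprime (q ^ s) := ((Nat.coprime_primes hp hq).2 hpq).pow r s
  rw [Nat.divisors_mul, Finset.mul_def, sum_image (by simpa using hcop.mul_injOn_divisors),
    sum_product, Nat.sum_divisors_prime_pow hp]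
  exact sum_congr rfl fun i _ => Nat.sum_divisors_prime_pow hq

/-- `b - 1` times the sum of the terms exceeding `T` of the geometric progression
`x, x * b, …, x * b ^ (n - 1)`. -/
noncomputable def geomTail (b T x : ℝ) (n : ℕ) : ℝ :=
  (b - 1) * ∑ j ∈ Finset.range n, if T < x * b ^ j then x * b ^ j else 0

theorem geomTail_eq_zero {b T x : ℝ} (hb : 1 ≤ b) (hx : 0 ≤ x) {n : ℕ} (h : x * b ^ n ≤ T) :
    geomTail b T x n = 0 := by
  rw [geomTail, Finset.sum_eq_zero, mul_zero]
  intro j hj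
  have hpow : b ^ j ≤ b ^ n := pow_le_pow_right₀ hb (Finset.mem_range.1 hj).le
  exact if_neg (((mul_le_mul_of_nonneg_left hpow hx).trans h).not_gt)

theorem geomTail_succ_le {b T x : ℝ} (hb : 1 ≤ b) (hx : 0 ≤ x) (n : ℕ) :
    geomTail b T x (n + 1) ≤ geomTail b T x n + (x * b ^ (n + 1) - x * b ^ n) := by
  have hterm : (if T < x * b ^ n then x * b ^ n else 0) ≤ x * b ^ n := by
    split_ifs
    · exact le_rfl
    · positivity
  have := mul_le_mul_of_nonneg_left hterm (sub_nonneg.2 hb)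
  simp only [geomTail, Finset.sum_range_succ, mul_add, pow_succ]
  linarith

theorem geomTail_le_sub_first {b T x : ℝ} (hb : 1 ≤ b) (hx : 0 ≤ x) (n : ℕ) :
    geomTail b T x n ≤ x * b ^ n - x := by
  induction n with
  | zero => simp [geomTail]
  | succ n ih => linarith [geomTail_succ_le (T := T) hb hx n]

theorem geomTail_le_sub_threshold {b T x : ℝ} (hb : 1 ≤ b) (hx : 0 ≤ x) {n : ℕ}
    (h : T ≤ x * b ^ n) : geomTail b T x n ≤ x * b ^ n - T := by
  induction n with
  | zero => simpa [geomTail] using h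
  | succ n ih =>
    rcases le_or_gt T (x * b ^ n) with hT | hT
    · linarith [ih hT, geomTail_succ_le (T := T) hb hx n]
    · have hsucc : geomTail b T x (n + 1) = geomTail b T x n := by
        simp [geomTail, Finset.sum_range_succ, hT.not_gt]
      rw [hsucc, geomTail_eq_zero hb hx hT.le]
      exact sub_nonneg.2 h

theorem geomTail_add_le_of_lt {b T x y : ℝ} {s : ℕ} (hb : 2 ≤ b) (hT : 0 < T) (hx : 0 ≤ x)
    (hy : 0 ≤ y) (hxy : x * y * b ^ s = T ^ 2) (h : x * b ^ (s + 1) < T) :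
    geomTail b T x (s + 1) + geomTail b T y (s + 1) ≤ (x + y) * b ^ (s + 1) - 2 * T := by
  have hb1 : 1 ≤ b := by linarith
  have hprod : T * (b * T) ≤ T * y := by
    calc T * (b * T) = b * T ^ 2 := by ring
      _ = x * b ^ (s + 1) * y := by rw [← hxy]; ring
      _ ≤ T * y := mul_le_mul_of_nonneg_right h.le hy
  have hyT : b * T ≤ y := le_of_mul_le_mul_left hprod hT
  have hbT : 2 * T ≤ b * T := mul_le_mul_of_nonneg_right hb hT.le
  have hx0 : 0 ≤ x * b ^ (s + 1) := by positivity
  rw [geomTail_eq_zero hb1 hx h.le]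
  linarith [geomTail_le_sub_first (T := T) hb1 hy (s + 1)]

theorem geomTail_add_le {b T x y : ℝ} {s : ℕ} (hb : 2 ≤ b) (hT : 0 < T) (hx : 0 ≤ x)
    (hy : 0 ≤ y) (hxy : x * y * b ^ s = T ^ 2) :
    geomTail b T x (s + 1) + geomTail b T y (s + 1) ≤ (x + y) * b ^ (s + 1) - 2 * T := by
  have hb1 : 1 ≤ b := by linarith
  rcases lt_or_ge (x * b ^ (s + 1)) T with hxT | hxT
  · exact geomTail_add_le_of_lt hb hT hx hy hxy hxT
  rcases lt_or_ge (y * b ^ (s + 1)) T with hyT | hyT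
  · linarith [geomTail_add_le_of_lt hb hT hy hx (by rwa [mul_comm y x]) hyT]
  · linarith [geomTail_le_sub_threshold hb1 hx hxT, geomTail_le_sub_threshold hb1 hy hyT]

theorem sum_geomTail_le {a b T : ℝ} {r s : ℕ} (ha : 0 ≤ a) (hb : 2 ≤ b) (hT : 0 < T)
    (h : a ^ r * b ^ s = T ^ 2) :
    ∑ i ∈ Finset.range (r + 1), geomTail b T (a ^ i) (s + 1) ≤
      (∑ i ∈ Finset.range (r + 1), a ^ i) * b ^ (s + 1) - (r + 1) * T := by
  have hpair : ∀ i ∈ Finset.range (r + 1),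
      geomTail b T (a ^ i) (s + 1) + geomTail b T (a ^ (r - i)) (s + 1) ≤
        (a ^ i + a ^ (r - i)) * b ^ (s + 1) - 2 * T := by
    intro i hi
    refine geomTail_add_le hb hT (pow_nonneg ha _) (pow_nonneg ha _) ?_
    rw [← pow_add, Nat.add_sub_cancel' (Finset.mem_range_succ_iff.1 hi), h]
  have hsum := Finset.sum_le_sum hpair
  have hreflect (f : ℕ → ℝ) :
      ∑ i ∈ Finset.range (r + 1), f (r - i) = ∑ i ∈ Finset.range (r + 1), f i := by
    simpa using Finset.sum_range_reflect f (r + 1)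
  rw [Finset.sum_add_distrib, hreflect fun i => geomTail b T (a ^ i) (s + 1),
    Finset.sum_sub_distrib, ← Finset.sum_mul, Finset.sum_add_distrib,
    hreflect fun i => a ^ i] at hsum
  simp only [Finset.sum_const, Finset.card_range, nsmul_eq_mul, Nat.cast_add, Nat.cast_one] at hsum
  linarith


theorem stmt_8 (ℓ₁ ℓ₂ : ℕ) (hℓ₁ : ℓ₁.Prime) (hℓ₂ : ℓ₂.Prime) (hlt : ℓ₁ < ℓ₂)
    (r s : ℕ) (hr : 1 ≤ r) (hs : 1 ≤ s) :
    ∑ d ∈ (ℓ₁ ^ r * ℓ₂ ^ s).divisors.filter (fun d => ℓ₁ ^ r * ℓ₂ ^ s < d ^ 2),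
        (d : ℝ) ≤
      ((ℓ₁ : ℝ) ^ (r + 1) * (ℓ₂ : ℝ) ^ (s + 1) - (ℓ₂ : ℝ) ^ (s + 1)
          - ((ℓ₁ : ℝ) - 1) * ((r : ℝ) + 1) * Real.sqrt ((ℓ₁ : ℝ) ^ r * (ℓ₂ : ℝ) ^ s))
        / (((ℓ₁ : ℝ) - 1) * ((ℓ₂ : ℝ) - 1)) := by
  have ha : (1 : ℝ) < ℓ₁ := by exact_mod_cast hℓ₁.one_lt
  have hb : (2 : ℝ) ≤ ℓ₂ := by exact_mod_cast hℓ₂.two_le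
  have hN : (0 : ℝ) < (ℓ₁ : ℝ) ^ r * (ℓ₂ : ℝ) ^ s := by positivity
  set T := √((ℓ₁ : ℝ) ^ r * (ℓ₂ : ℝ) ^ s) with hTdef
  have hT : 0 < T := Real.sqrt_pos.2 hN
  have hbound := sum_geomTail_le (zero_le_one.trans ha.le) hb hT (Real.sq_sqrt hN.le).symm
  have hiff (d : ℕ) : ℓ₁ ^ r * ℓ₂ ^ s < d ^ 2 ↔ T < d := by
    rw [hTdef, Real.sqrt_lt hN.le d.cast_nonneg]
    exact_mod_cast Iff.rfl
  have hsum : ((ℓ₂ : ℝ) - 1) *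
      ∑ d ∈ (ℓ₁ ^ r * ℓ₂ ^ s).divisors.filter (fun d => ℓ₁ ^ r * ℓ₂ ^ s < d ^ 2), (d : ℝ) =
      ∑ i ∈ Finset.range (r + 1), geomTail ℓ₂ T ((ℓ₁ : ℝ) ^ i) (s + 1) := by
    simp only [Finset.sum_filter, hiff, sum_divisors_mul_prime_pow hℓ₁ hℓ₂ hlt.ne, geomTail,
      Finset.mul_sum, Nat.cast_mul, Nat.cast_pow]
  have hgeom := geom_sum_mul (ℓ₁ : ℝ) (r + 1)
  have ha' : (0 : ℝ) < ℓ₁ - 1 := by linarith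
  have hb' : (0 : ℝ) < ℓ₂ - 1 := by linarith
  rw [le_div_iff₀ (mul_pos ha' hb')]
  calc _ = (ℓ₁ - 1 : ℝ) * ∑ i ∈ Finset.range (r + 1), geomTail ℓ₂ T ((ℓ₁ : ℝ) ^ i) (s + 1) := by
        rw [← hsum]; ring
    _ ≤ (ℓ₁ - 1 : ℝ) * ((∑ i ∈ Finset.range (r + 1), (ℓ₁ : ℝ) ^ i) * (ℓ₂ : ℝ) ^ (s + 1)
          - (r + 1) * T) := mul_le_mul_of_nonneg_left hbound ha'.le
    _ = _ := by linear_combination (ℓ₂ : ℝ) ^ (s + 1) * hgeom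
end
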